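/- Let (G, X*) be a contracting self-similar action with limit G-space J_G, measure μ (push-forward of uniform Bernoulli measure times counting measure on G), and tile T. Then: (1) μ(T_v) = |X|^n · μ(T_{uv}) for every word v ∈ X* and u ∈ X^n; (2) μ(T_v ∩ T_{v'}) = 0 for distinct words v, v' of the same length; (3) the restriction μ|_T satisfies the self-similarity equation μ|_T(A) = Σ_{x∈X} (1/|X|) μ|_T(τ_x^{-1}(A)) for every Borel set A ⊂ T. -/

import Mathlib

open MeasureTheory ENNReal

/-- A self-similar action of the group `G` over the alphabet `X`, given by the action
`g(xw) = (toFun g x) ((res g x) w)` on words: `toFun g` is the action on the first letter and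
`res g x = g|_x` is the restriction. -/
structure SSA (G X : Type*) [Group G] where
  toFun : G → X → X
  res : G → X → G
  toFun_one : ∀ x, toFun 1 x = x
  res_one : ∀ x, res 1 x = 1
  toFun_mul : ∀ g h x, toFun (g * h) x = toFun g (toFun h x)
  res_mul : ∀ g h x, res (g * h) x = res g (toFun h x) * res h x

namespace SSA

variable {G X : Type*} [Group G]

/-- Restriction of `g` along a finite word (head of the list = first letter read):
`g|_{x₁x₂…xₙ} = g|_{x₁}|_{x₂}…|_{xₙ}`. -/
def resW (S : SSA G X) : G → List X → G
  | g, [] => g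
  | g, x :: v => S.resW (S.res g x) v

/-- Action of `g` on a finite word (head of the list = first letter read):
`g(xw) = g(x) (g|_x)(w)`. -/
def actW (S : SSA G X) : G → List X → List X
  | _, [] => []
  | g, x :: v => S.toFun g x :: S.actW (S.res g x) v

/-- `N` is the nucleus of the (contracting) action: it is closed under restrictions, every
element restricts into `N` on all sufficiently long words, and it is the smallest such set. -/
def IsNucleus (S : SSA G X) (N : Finset G) : Prop :=
  (∀ g ∈ N, ∀ x : X, S.res g x ∈ N) ∧
  (∀ g : G, ∃ k : ℕ, ∀ v : List X, k ≤ v.length → S.resW g v ∈ N) ∧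
  ∀ N' : Finset G, (∀ g : G, ∃ k : ℕ, ∀ v : List X, k ≤ v.length → S.resW g v ∈ N') → N ⊆ N'

/-- There is a left-infinite path in the Moore diagram of the nucleus `N` which ends at the
vertex `h` and whose `i`-th edge is labeled `(w i, w' i)` (sequences are left-infinite,
index `0` being the rightmost letter): the vertices `q i ∈ N` satisfy
`q (i+1)|_{w i} = q i` and `q (i+1) (w i) = w' i`, with `q 0 = h`. -/
def MoorePath (S : SSA G X) (N : Finset G) (w w' : ℕ → X) (h : G) : Prop :=
  ∃ q : ℕ → G, q 0 = h ∧ (∀ i, q i ∈ N) ∧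
    ∀ i : ℕ, S.res (q (i + 1)) (w i) = q i ∧ S.toFun (q (i + 1)) (w i) = w' i

/-- The asymptotic equivalence relation on `X^{-ω} × G`: `w·g ~ w'·g'` iff there is a
left-infinite path in the Moore diagram of the nucleus labeled `(w, w')` ending at `g'g⁻¹`. -/
def AsympEquiv (S : SSA G X) (N : Finset G) (p q : (ℕ → X) × G) : Prop :=
  S.MoorePath N p.1 q.1 (q.2 * p.2⁻¹)

/-- The limit `G`-space: the quotient of `X^{-ω} × G` by the asymptotic equivalence relation. -/
def LimitGSpace (S : SSA G X) (N : Finset G) : Type _ :=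
  Quot (S.AsympEquiv N)

/-- The tile `𝒯_v ⊂ J_G` for a finite word `v` (encoded as a list whose head is the rightmost
letter): the image in the limit `G`-space of `X^{-ω}v × {1}`.  For `v = []` this is the tile `𝒯`,
the image of `X^{-ω} × {1}`. -/
def Tile (S : SSA G X) (N : Finset G) (v : List X) : Set (S.LimitGSpace N) :=
  Quot.mk (S.AsympEquiv N) ''
    {p : (ℕ → X) × G | p.2 = 1 ∧ ∀ (i : ℕ) (h : i < v.length), p.1 i = v.get ⟨i, h⟩}

/-- The translated tile `𝒯·g`: the image in the limit `G`-space of `X^{-ω} × {g}`. -/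
def TileT (S : SSA G X) (N : Finset G) (g : G) : Set (S.LimitGSpace N) :=
  Quot.mk (S.AsympEquiv N) '' {p : (ℕ → X) × G | p.2 = g}

variable [MeasurableSpace X] [MeasurableSpace G]

instance (S : SSA G X) (N : Finset G) : MeasurableSpace (S.LimitGSpace N) :=
  inferInstanceAs (MeasurableSpace (Quot (S.AsympEquiv N)))

/-- The measure `μ` on the limit `G`-space: the push-forward under the quotient map of the
product of the (uniform Bernoulli) measure `μ0` on `X^{-ω}` and the counting measure on `G`. -/
noncomputable def limitMeasure (S : SSA G X) (N : Finset G) (μ0 : Measure (ℕ → X)) :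
    Measure (S.LimitGSpace N) :=
  Measure.map (Quot.mk (S.AsympEquiv N)) (μ0.prod Measure.count)

end SSA

/-- The cylinder subset of `X^{-ω}` of sequences whose last `u.length` letters spell `u`
(head of `u` = rightmost letter). -/
def Cyl {X : Type*} (u : List X) : Set (ℕ → X) :=
  {w | ∀ (i : ℕ) (h : i < u.length), w i = u.get ⟨i, h⟩}

instance {G X : Type*} [Group G] [TopologicalSpace X] [TopologicalSpace G]
    (S : SSA G X) (N : Finset G) : TopologicalSpace (S.LimitGSpace N) :=
  inferInstanceAs (TopologicalSpace (Quot (S.AsympEquiv N)))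

set_option linter.unusedSectionVars false

namespace SSAProof

variable {G X : Type*} [Group G]

/-- restriction of an inverse -/
lemma res_inv (S : SSA G X) (g : G) (x : X) : S.res g⁻¹ (S.toFun g x) = (S.res g x)⁻¹ := by
  have h := S.res_mul g⁻¹ g x
  rw [inv_mul_cancel, S.res_one] at h
  exact eq_inv_of_mul_eq_one_left h.symm

lemma toFun_inv (S : SSA G X) (g : G) (x : X) : S.toFun g⁻¹ (S.toFun g x) = x := by
  rw [← S.toFun_mul, inv_mul_cancel, S.toFun_one]

lemma toFun_inv' (S : SSA G X) (g : G) (x : X) : S.toFun g (S.toFun g⁻¹ x) = x := by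
  rw [← S.toFun_mul, mul_inv_cancel, S.toFun_one]

lemma resW_inv (S : SSA G X) (v : List X) (g : G) :
    S.resW g⁻¹ (S.actW g v) = (S.resW g v)⁻¹ := by
  induction v generalizing g with
  | nil => rfl
  | cons x v ih =>
    simp only [SSA.resW, SSA.actW]
    rw [res_inv, ih]

lemma length_actW (S : SSA G X) (v : List X) (g : G) : (S.actW g v).length = v.length := by
  induction v generalizing g with
  | nil => rfl
  | cons x v ih => simp [SSA.actW, ih]

lemma resW_one (S : SSA G X) (v : List X) : S.resW 1 v = 1 := by
  induction v with
  | nil => rfl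
  | cons x v ih => simpa [SSA.resW, S.res_one] using ih

lemma one_mem [Nonempty X] {S : SSA G X} {N : Finset G} (hN : S.IsNucleus N) : (1 : G) ∈ N := by
  obtain ⟨k, hk⟩ := hN.2.1 1
  have := hk (List.replicate k (Classical.arbitrary X)) (by simp)
  rwa [resW_one] at this

lemma inv_mem {S : SSA G X} {N : Finset G} (hN : S.IsNucleus N) {g : G} (hg : g ∈ N) :
    g⁻¹ ∈ N := by
  classical
  have h := hN.2.2 (N.image (fun g => g⁻¹)) (by
    intro g
    obtain ⟨k, hk⟩ := hN.2.1 g⁻¹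
    refine ⟨k, fun v hv => ?_⟩
    have := hk (S.actW g v) (by rwa [length_actW])
    rw [resW_inv] at this
    exact Finset.mem_image.2 ⟨_, this, by simp⟩)
  obtain ⟨a, ha, h2⟩ := Finset.mem_image.1 (h hg)
  rw [← h2]; simpa using ha

lemma exists_word (S : SSA G X) (q : ℕ → G) (w : ℕ → X)
    (hq : ∀ i, S.res (q (i + 1)) (w i) = q i) (k i : ℕ) :
    ∃ v : List X, v.length = k ∧ S.resW (q (i + k)) v = q i := by
  induction k with
  | zero => exact ⟨[], rfl, rfl⟩
  | succ k ih =>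
    obtain ⟨v, hv, h⟩ := ih
    refine ⟨w (i + k) :: v, by simp [hv], ?_⟩
    simp only [SSA.resW]
    rw [← add_assoc, hq, h]

lemma asymp_equivalence [Nonempty X] {S : SSA G X} {N : Finset G} (hN : S.IsNucleus N) :
    Equivalence (S.AsympEquiv N) := by
  classical
  refine ⟨?_, ?_, ?_⟩
  · intro p
    exact ⟨fun _ => 1, by simp, fun _ => one_mem hN, fun i => ⟨S.res_one _, S.toFun_one _⟩⟩
  · rintro p p' ⟨q, h0, hq, h⟩
    refine ⟨fun i => (q i)⁻¹, by simp [h0], fun i => inv_mem hN (hq i), fun i => ?_⟩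
    rw [← (h i).2]
    refine ⟨?_, toFun_inv _ _ _⟩
    rw [res_inv, (h i).1]
  · rintro p p' p'' ⟨q, h0, hq, h⟩ ⟨q', h0', hq', h'⟩
    have hr : ∀ i, S.res (q' (i + 1) * q (i + 1)) (p.1 i) = q' i * q i := by
      intro i
      rw [S.res_mul, (h i).2, (h i).1, (h' i).1]
    choose K hK using hN.2.1
    let NN : Finset (G × G) := N ×ˢ N
    let k := NN.sup (fun ab => K (ab.1 * ab.2))
    refine ⟨fun i => q' i * q i, by simp [h0, h0'], fun i => ?_, fun i => ⟨hr i, ?_⟩⟩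
    · obtain ⟨v, hv, hv'⟩ := exists_word S (fun i => q' i * q i) p.1 hr k i
      change q' i * q i ∈ N
      rw [← hv']
      apply hK
      rw [hv]
      exact Finset.le_sup (f := fun ab : G × G => K (ab.1 * ab.2)) (b := (q' (i + k), q (i + k)))
        (Finset.mem_product.2 ⟨hq' _, hq _⟩)
    · rw [S.toFun_mul, (h i).2, (h' i).2]

/-- `p` is the end of a path with input `w` and output ending in `v`. -/
def E (S : SSA G X) (N : Finset G) (v : List X) (w : ℕ → X) (p : G) : Prop :=
  ∃ q : ℕ → G, q 0 = p ∧ (∀ i, q i ∈ N) ∧ (∀ i, S.res (q (i + 1)) (w i) = q i) ∧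
    ∀ (i : ℕ) (h : i < v.length), S.toFun (q (i + 1)) (w i) = v.get ⟨i, h⟩

def shift (w : ℕ → X) : ℕ → X := fun i => w (i + 1)

def cns (y : X) (w : ℕ → X) : ℕ → X := fun i => Nat.casesOn i y w

lemma mem_tile [Nonempty X] {S : SSA G X} {N : Finset G} (hN : S.IsNucleus N) (v : List X)
    (w : ℕ → X) (h : G) :
    (Quot.mk (S.AsympEquiv N) (w, h) : S.LimitGSpace N) ∈ S.Tile N v ↔ E S N v w h⁻¹ := by
  constructor
  · rintro ⟨⟨w1, g⟩, ⟨hg, hw⟩, he⟩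
    simp only at hg hw
    subst hg
    have he' := Quot.eqvGen_exact he.symm
    rw [(asymp_equivalence hN).eqvGen_iff] at he'
    obtain ⟨q, h0, hq, hh⟩ := he'
    exact ⟨q, by simpa using h0, hq, fun i => (hh i).1, fun i hi => by rw [(hh i).2]; exact hw i hi⟩
  · rintro ⟨q, h0, hq, hr, hv⟩
    refine ⟨(fun i => S.toFun (q (i + 1)) (w i), 1), ⟨rfl, hv⟩, ?_⟩
    refine (Quot.sound ?_).symm
    exact ⟨q, by simpa using h0, hq, fun i => ⟨hr i, rfl⟩⟩

lemma E_nil_of {S : SSA G X} {N : Finset G} {v : List X} {w : ℕ → X} {p : G}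
    (h : E S N v w p) : E S N [] w p := by
  obtain ⟨q, h0, hq, hr, hv⟩ := h
  exact ⟨q, h0, hq, hr, fun i hi => absurd hi (by simp)⟩

lemma E_mem {S : SSA G X} {N : Finset G} {v : List X} {w : ℕ → X} {p : G}
    (h : E S N v w p) : p ∈ N := by
  obtain ⟨q, h0, hq, hr, hv⟩ := h
  rw [← h0]; exact hq 0

lemma E_nil_iff {S : SSA G X} {N : Finset G} (hN : S.IsNucleus N) (w : ℕ → X) (r : G) :
    E S N [] w r ↔ ∃ p, E S N [] (shift w) p ∧ S.res p (w 0) = r := by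
  constructor
  · rintro ⟨q, h0, hq, hr, hv⟩
    exact ⟨q 1, ⟨fun i => q (i + 1), rfl, fun i => hq _, fun i => hr (i + 1),
      fun i hi => absurd hi (by simp)⟩, by rw [← h0]; exact hr 0⟩
  · rintro ⟨p, ⟨q, h0, hq, hr, hv⟩, h⟩
    refine ⟨cns r q, rfl, ?_, ?_, fun i hi => absurd hi (by simp)⟩
    · rintro (_ | i)
      · rw [← h, ← h0]; exact hN.1 _ (hq 0) _
      · exact hq i
    · rintro (_ | i)
      · rw [← h, ← h0]; rfl
      · exact hr i

lemma E_cons_iff {S : SSA G X} {N : Finset G} (hN : S.IsNucleus N) (x : X) (v : List X)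
    (w : ℕ → X) (r : G) :
    E S N (x :: v) w r ↔
      ∃ p, (E S N v (shift w) p ∧ S.toFun p (w 0) = x) ∧ S.res p (w 0) = r := by
  constructor
  · rintro ⟨q, h0, hq, hr, hv⟩
    exact ⟨q 1, ⟨⟨fun i => q (i + 1), rfl, fun i => hq _, fun i => hr (i + 1),
      fun i hi => hv (i + 1) (by simpa using hi)⟩, hv 0 (by simp)⟩, by rw [← h0]; exact hr 0⟩
  · rintro ⟨p, ⟨⟨q, h0, hq, hr, hv⟩, hx⟩, h⟩
    refine ⟨cns r q, rfl, ?_, ?_, ?_⟩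
    · rintro (_ | i)
      · rw [← h, ← h0]; exact hN.1 _ (hq 0) _
      · exact hq i
    · rintro (_ | i)
      · rw [← h, ← h0]; rfl
      · exact hr i
    · rintro (_ | i) hi
      · rw [← h0] at hx; exact hx
      · exact hv i (by simpa using hi)

section Meas

variable [Fintype X] [MeasurableSpace X]

lemma singleton_class (μ0 : Measure (ℕ → X)) [Nonempty X]
    (hμ0 : ∀ u : List X, μ0 (Cyl u) = ((Fintype.card X : ℝ≥0∞))⁻¹ ^ u.length) :
    MeasurableSingletonClass X := by
  classical
  refine ⟨fun x => ?_⟩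
  have hm : MeasurableSet (measurableAtom x) := MeasurableSet.measurableAtom_of_countable x
  suffices h : measurableAtom x = {x} by rwa [h] at hm
  refine Set.Subset.antisymm (fun y hy => ?_) (by simp)
  by_contra hne
  simp only [Set.mem_singleton_iff] at hne
  have hsub : ∀ w : ℕ → X, w ∈ ⋃ z ∈ Finset.univ.erase y, toMeasurable μ0 (Cyl [z]) := by
    intro w
    have key : ∀ z (w : ℕ → X), w 0 = z → w ∈ toMeasurable μ0 (Cyl [z]) := by
      intro z w hw
      apply subset_toMeasurable
      intro i hi
      have : i = 0 := by simpa using hi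
      subst this
      simpa using hw
    by_cases hw : w 0 = y
    · refine Set.mem_biUnion (x := x) (by simp [Ne.symm hne]) ?_
      have hB : MeasurableSet (Function.update w 0 ⁻¹' (toMeasurable μ0 (Cyl [x]))) :=
        (measurable_update w) (measurableSet_toMeasurable _ _)
      have h1 := mem_of_mem_measurableAtom hy hB (by
        apply key; simp)
      rw [Set.mem_preimage, ← hw, Function.update_eq_self] at h1
      exact h1
    · exact Set.mem_biUnion (x := w 0) (by simp [hw]) (key _ _ rfl)
  have h1 : μ0 Set.univ = 1 := by
    have := hμ0 []
    have h2 : Cyl ([] : List X) = Set.univ := by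
      ext w; simp [Cyl]
    simpa [h2] using this
  have h2 : (1 : ℝ≥0∞) ≤ ∑ z ∈ Finset.univ.erase y, (Fintype.card X : ℝ≥0∞)⁻¹ := by
    rw [← h1]
    calc μ0 Set.univ ≤ μ0 (⋃ z ∈ Finset.univ.erase y, toMeasurable μ0 (Cyl [z])) :=
          measure_mono (fun w _ => hsub w)
      _ ≤ ∑ z ∈ Finset.univ.erase y, μ0 (toMeasurable μ0 (Cyl [z])) :=
          measure_biUnion_finset_le _ _
      _ = _ := by
          refine Finset.sum_congr rfl fun z _ => ?_
          rw [measure_toMeasurable, hμ0]; simp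
  rw [Finset.sum_const, nsmul_eq_mul, Finset.card_erase_of_mem (Finset.mem_univ _),
    Finset.card_univ, ← div_eq_mul_inv, ENNReal.le_div_iff_mul_le (by simp) (by simp), one_mul] at h2
  have h3 : 0 < Fintype.card X := Fintype.card_pos
  have h4 : Fintype.card X ≤ Fintype.card X - 1 := by exact_mod_cast h2
  omega

lemma measurable_shift : Measurable (shift : (ℕ → X) → (ℕ → X)) := by
  unfold shift
  fun_prop

lemma measurable_cns (y : X) : Measurable (cns y : (ℕ → X) → (ℕ → X)) := by
  refine measurable_pi_lambda _ ?_
  rintro (_ | i)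
  · exact measurable_const
  · exact measurable_pi_apply i

variable [MeasurableSingletonClass X]

lemma measurableSet_cyl (u : List X) : MeasurableSet (Cyl u) := by
  have : Cyl u = ⋂ (i : ℕ) (h : i < u.length), {w | w i = u.get ⟨i, h⟩} := by
    ext w; simp [Cyl]
  rw [this]
  refine MeasurableSet.iInter fun i => MeasurableSet.iInter fun h => ?_
  exact measurable_pi_apply i (measurableSet_singleton _)

lemma cyl_pi : IsPiSystem (Set.range (Cyl (X := X))) := by
  have key : ∀ u v : List X, u.length ≤ v.length → (Cyl u ∩ Cyl v).Nonempty →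
      Cyl u ∩ Cyl v = Cyl v := by
    rintro u v hl ⟨w, hu, hv⟩
    refine Set.inter_eq_right.2 fun w' hw' i hi => ?_
    rw [hw' i (by omega), ← hv i (by omega), hu i hi]
  rintro _ ⟨u, rfl⟩ _ ⟨v, rfl⟩ hne
  rcases le_total u.length v.length with h | h
  · exact ⟨v, (key u v h hne).symm⟩
  · rw [Set.inter_comm] at hne ⊢
    exact ⟨u, (key v u h hne).symm⟩

lemma cyl_gen : (MeasurableSpace.pi : MeasurableSpace (ℕ → X)) =
    MeasurableSpace.generateFrom (Set.range (Cyl (X := X))) := by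
  apply le_antisymm
  · refine iSup_le fun i => ?_
    rintro _ ⟨s, hs, rfl⟩
    have : (fun w : ℕ → X => w i) ⁻¹' s =
        ⋃ u ∈ {u : List X | u.length = i + 1 ∧ ∀ h : i < u.length, u.get ⟨i, h⟩ ∈ s}, Cyl u := by
      ext w
      simp only [Set.mem_preimage, Set.mem_iUnion, Set.mem_ofPred_eq, exists_prop]
      constructor
      · intro hw
        refine ⟨(List.range (i + 1)).map w, ⟨by simp, fun h => ?_⟩, ?_⟩
        · rw [List.get_eq_getElem, List.getElem_map, List.getElem_range]
          exact hw
        · intro j hj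
          rw [List.get_eq_getElem, List.getElem_map, List.getElem_range]
      · rintro ⟨u, ⟨h1, h2⟩, hu⟩
        rw [hu i (by omega)]
        exact h2 (by omega)
    rw [this]
    refine MeasurableSet.biUnion (Set.to_countable _) fun u _ => ?_
    exact MeasurableSpace.measurableSet_generateFrom ⟨u, rfl⟩
  · refine MeasurableSpace.generateFrom_le ?_
    rintro _ ⟨u, rfl⟩
    exact measurableSet_cyl u

variable (μ0 : Measure (ℕ → X)) [Nonempty X]

lemma prob (hμ0 : ∀ u : List X, μ0 (Cyl u) = ((Fintype.card X : ℝ≥0∞))⁻¹ ^ u.length) :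
    IsProbabilityMeasure μ0 := by
  refine ⟨?_⟩
  have := hμ0 []
  have h2 : Cyl ([] : List X) = Set.univ := by
    ext w; simp [Cyl]
  simpa [h2] using this

lemma cns_cyl (x y : X) (u : List X) :
    cns y ⁻¹' (Cyl (x :: u)) = {w | y = x ∧ w ∈ Cyl u} := by
  ext w
  constructor
  · intro h
    exact ⟨h 0 (by simp), fun i hi => h (i + 1) (by simpa using hi)⟩
  · rintro ⟨h1, h2⟩
    rintro (_ | i) hi
    · exact h1
    · exact h2 i (by simpa using hi)

lemma card_mul : (Fintype.card X : ℝ≥0∞) * (Fintype.card X : ℝ≥0∞)⁻¹ = 1 :=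
  ENNReal.mul_inv_cancel (by simp) (by simp)

lemma decomp (hμ0 : ∀ u : List X, μ0 (Cyl u) = ((Fintype.card X : ℝ≥0∞))⁻¹ ^ u.length)
    {B : Set (ℕ → X)} (hB : MeasurableSet B) :
    μ0 B = ∑ y : X, (Fintype.card X : ℝ≥0∞)⁻¹ * μ0 (cns y ⁻¹' B) := by
  classical
  have := prob μ0 hμ0
  let ν : Measure (ℕ → X) := ∑ y : X, (Fintype.card X : ℝ≥0∞)⁻¹ • Measure.map (cns y) μ0
  have hν : ∀ B, MeasurableSet B → ν B = ∑ y : X, (Fintype.card X : ℝ≥0∞)⁻¹ * μ0 (cns y ⁻¹' B) := by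
    intro B hB
    simp only [ν, Measure.finsetSum_apply, Measure.smul_apply, smul_eq_mul]
    refine Finset.sum_congr rfl fun y _ => ?_
    rw [Measure.map_apply (measurable_cns y) hB]
  have huniv : μ0 Set.univ = ν Set.univ := by
    rw [hν _ MeasurableSet.univ]
    simp [card_mul]
  rw [← hν B hB]
  congr 1
  refine ext_of_generate_finite _ cyl_gen cyl_pi ?_ huniv
  rintro _ ⟨u, rfl⟩
  cases u with
  | nil =>
    have h2 : Cyl ([] : List X) = Set.univ := by
      ext w; simp [Cyl]
    rw [h2, huniv]
  | cons x u =>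
    rw [hν _ (measurableSet_cyl _), hμ0]
    simp only [cns_cyl]
    rw [Finset.sum_eq_single x]
    · simp [hμ0, pow_succ, mul_comm]
    · intro y _ hy; simp [hy]
    · simp

lemma shift_cns (y : X) (w : ℕ → X) : shift (cns y w) = w := rfl

lemma shift_mp (hμ0 : ∀ u : List X, μ0 (Cyl u) = ((Fintype.card X : ℝ≥0∞))⁻¹ ^ u.length) :
    MeasurePreserving shift μ0 μ0 := by
  refine ⟨measurable_shift, ?_⟩
  ext B hB
  rw [Measure.map_apply measurable_shift hB, decomp μ0 hμ0 (measurable_shift hB)]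
  have : ∀ y : X, cns y ⁻¹' (shift ⁻¹' B) = B := fun y => rfl
  simp only [this]
  rw [Finset.sum_const, nsmul_eq_mul, ← mul_assoc, Finset.card_univ, card_mul, one_mul]

lemma measurableSet_E_nil (S : SSA G X) (N : Finset G) (p : G) :
    MeasurableSet {w | E S N [] w p} := by
  let : TopologicalSpace X := ⊥
  have : DiscreteTopology X := ⟨rfl⟩
  have : BorelSpace X := ⟨by
    rw [borel_eq_top_of_discrete]
    exact top_unique fun s _ => s.toFinite.measurableSet⟩
  let : TopologicalSpace N := ⊥
  have : DiscreteTopology N := ⟨rfl⟩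
  let C : Set ((ℕ → X) × (ℕ → N)) :=
    {a | (a.2 0 : G) = p} ∩ ⋂ i, {a | S.res (a.2 (i + 1)) (a.1 i) = a.2 i}
  have hC : IsClosed C := by
    refine IsClosed.inter ?_ (isClosed_iInter fun i => ?_)
    · have hf : Continuous (fun a : (ℕ → X) × (ℕ → N) => a.2 0) := by fun_prop
      exact (isClosed_discrete {n : N | (n : G) = p}).preimage hf
    · have hf : Continuous (fun a : (ℕ → X) × (ℕ → N) => (a.1 i, a.2 i, a.2 (i + 1))) := by fun_prop
      exact (isClosed_discrete {n : X × N × N | S.res n.2.2 n.1 = n.2.1}).preimage hf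
  have h : {w | E S N [] w p} = Prod.fst '' C := by
    ext w
    constructor
    · rintro ⟨q, h0, hq, hr, -⟩
      exact ⟨(w, fun i => ⟨q i, hq i⟩), ⟨h0, Set.mem_iInter.2 fun i => hr i⟩, rfl⟩
    · rintro ⟨⟨w, q⟩, ⟨h0, hr⟩, rfl⟩
      exact ⟨fun i => q i, h0, fun i => (q i).2, fun i => Set.mem_iInter.1 hr i,
        fun i hi => absurd hi (by simp)⟩
  rw [h]
  exact (isClosedMap_fst_of_compactSpace _ hC).measurableSet

lemma measurableSet_coord (i : ℕ) (P : X → Prop) : MeasurableSet {w : ℕ → X | P (w i)} :=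
  measurable_pi_apply i (Set.toFinite {x | P x}).measurableSet

lemma measurableSet_E [Countable G] {S : SSA G X} {N : Finset G} (hN : S.IsNucleus N)
    (v : List X) : ∀ p : G, MeasurableSet {w | E S N v w p} := by
  induction v with
  | nil => exact measurableSet_E_nil S N
  | cons x v ih =>
    intro r
    have : {w | E S N (x :: v) w r} = ⋃ p, (shift ⁻¹' {w | E S N v w p} ∩
        {w | S.toFun p (w 0) = x ∧ S.res p (w 0) = r}) := by
      ext w
      simp only [Set.mem_ofPred_eq, E_cons_iff hN, Set.mem_iUnion, Set.mem_inter_iff,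
        Set.mem_preimage, and_assoc]
    rw [this]
    exact MeasurableSet.iUnion fun p => (measurable_shift (ih p)).inter
      (measurableSet_coord 0 (fun y => S.toFun p y = x ∧ S.res p y = r))

/-- almost everywhere injectivity of the restriction map on ends -/
lemma ae_inj {S : SSA G X} {N : Finset G} (hN : S.IsNucleus N)
    (hμ0 : ∀ u : List X, μ0 (Cyl u) = ((Fintype.card X : ℝ≥0∞))⁻¹ ^ u.length) :
    ∀ᵐ w ∂μ0, ∀ p p', E S N [] (shift w) p → E S N [] (shift w) p' →
      S.res p (w 0) = S.res p' (w 0) → p = p' := by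
  classical
  have := prob μ0 hμ0
  let F : (ℕ → X) → Finset G := fun w => N.filter (fun p => E S N [] w p)
  let f : (ℕ → X) → ℝ≥0∞ := fun w => ((F w).card : ℝ≥0∞)
  have hF : ∀ w p, p ∈ F w ↔ E S N [] w p := fun w p => by
    simp only [F, Finset.mem_filter]
    exact ⟨fun h => h.2, fun h => ⟨E_mem h, h⟩⟩
  have himg : ∀ w, F w = (F (shift w)).image (fun p => S.res p (w 0)) := by
    intro w; ext r
    rw [hF, E_nil_iff hN, Finset.mem_image]
    simp only [hF]
  have hf : Measurable f := by
    have : f = fun w => ∑ p ∈ N, Set.indicator {w | E S N [] w p} (fun _ => (1 : ℝ≥0∞)) w := by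
      funext w
      simp [f, F, Set.indicator_apply]
    rw [this]
    exact Finset.measurable_sum _ fun p _ => measurable_const.indicator (measurableSet_E_nil S N p)
  have hle : ∀ w, f w ≤ f (shift w) := by
    intro w
    simp only [f]
    rw [himg w]
    exact_mod_cast Finset.card_image_le
  have hint : ∫⁻ w, f (shift w) ∂μ0 = ∫⁻ w, f w ∂μ0 := (shift_mp μ0 hμ0).lintegral_comp hf
  have hfin : ∫⁻ w, f w ∂μ0 ≠ ∞ := by
    refine ne_of_lt (lt_of_le_of_lt (lintegral_mono (g := fun _ => (N.card : ℝ≥0∞)) ?_) ?_)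
    · intro w
      simp only [f]
      exact_mod_cast Finset.card_filter_le _ _
    · simp
  have hae : f =ᵐ[μ0] fun w => f (shift w) :=
    ae_eq_of_ae_le_of_lintegral_le (Filter.Eventually.of_forall hle) hfin
      (hf.comp measurable_shift).aemeasurable hint.le
  filter_upwards [hae] with w hw p p' hp hp' he
  have hc : ((F (shift w)).image (fun p => S.res p (w 0))).card = (F (shift w)).card := by
    rw [← himg w]
    exact Nat.cast_injective (R := ℝ≥0∞) hw
  exact Finset.card_image_iff.1 hc (by simpa using (hF _ _).2 hp) (by simpa using (hF _ _).2 hp') he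

lemma key [Countable G] {S : SSA G X} {N : Finset G} (hN : S.IsNucleus N)
    (hμ0 : ∀ u : List X, μ0 (Cyl u) = ((Fintype.card X : ℝ≥0∞))⁻¹ ^ u.length)
    (P : (ℕ → X) → G → Prop) (hP : ∀ p, MeasurableSet {w | P w p})
    (hE : ∀ w p, P w p → E S N [] (shift w) p) :
    ∑' r : G, μ0 {w | ∃ p, P w p ∧ S.res p (w 0) = r} = ∑' p : G, μ0 {w | P w p} := by
  have hm : ∀ p r, MeasurableSet {w | P w p ∧ S.res p (w 0) = r} := fun p r =>
    (hP p).inter (measurableSet_coord 0 (fun y => S.res p y = r))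
  have h1 : ∀ r, μ0 {w | ∃ p, P w p ∧ S.res p (w 0) = r} =
      ∑' p : G, μ0 {w | P w p ∧ S.res p (w 0) = r} := by
    intro r
    rw [← measure_iUnion₀ _ fun p => (hm p r).nullMeasurableSet]
    · congr 1; ext w; simp
    · intro p p' hne
      have := ae_inj μ0 hN hμ0
      refine measure_mono_null ?_ (ae_iff.1 this)
      rintro w ⟨⟨h1, h2⟩, ⟨h3, h4⟩⟩ hall
      exact hne (hall p p' (hE _ _ h1) (hE _ _ h3) (h2.trans h4.symm))
  have h2 : ∀ p, μ0 {w | P w p} = ∑' r : G, μ0 {w | P w p ∧ S.res p (w 0) = r} := by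
    intro p
    rw [← measure_iUnion _ fun r => hm p r]
    · congr 1; ext w; simp
    · intro r r' hne
      refine Set.disjoint_left.2 ?_
      rintro w ⟨_, h⟩ ⟨_, h'⟩
      exact hne (h.symm.trans h')
  simp only [h1]
  rw [ENNReal.tsum_comm]
  simp only [← h2]

lemma sum_cons [Countable G] {S : SSA G X} {N : Finset G} (hN : S.IsNucleus N)
    (hμ0 : ∀ u : List X, μ0 (Cyl u) = ((Fintype.card X : ℝ≥0∞))⁻¹ ^ u.length)
    (x : X) (v : List X) :
    ∑' r : G, μ0 {w | E S N (x :: v) w r} =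
      (Fintype.card X : ℝ≥0∞)⁻¹ * ∑' p : G, μ0 {w | E S N v w p} := by
  simp only [E_cons_iff hN]
  have hm : ∀ p, MeasurableSet {w | E S N v (shift w) p ∧ S.toFun p (w 0) = x} := fun p =>
    (measurable_shift (measurableSet_E hN v p)).inter
      (measurableSet_coord 0 (fun y => S.toFun p y = x))
  rw [key μ0 hN hμ0 (fun w p => E S N v (shift w) p ∧ S.toFun p (w 0) = x) hm
    (fun w p h => E_nil_of h.1), ← ENNReal.tsum_mul_left]
  refine tsum_congr fun p => ?_
  rw [decomp μ0 hμ0 (hm p)]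
  have hpre : ∀ y, cns y ⁻¹' {w | E S N v (shift w) p ∧ S.toFun p (w 0) = x} =
      {w | E S N v w p ∧ S.toFun p y = x} := fun y => rfl
  simp only [hpre]
  rw [Finset.sum_eq_single (S.toFun p⁻¹ x)]
  · simp [toFun_inv']
  · intro y _ hy
    have : S.toFun p y ≠ x := by
      rintro rfl
      exact hy (toFun_inv S p y).symm
    simp [this]
  · simp

lemma ae_disj {S : SSA G X} {N : Finset G} (hN : S.IsNucleus N)
    (hμ0 : ∀ u : List X, μ0 (Cyl u) = ((Fintype.card X : ℝ≥0∞))⁻¹ ^ u.length)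
    (v : List X) : ∀ v' : List X, v.length = v'.length → v ≠ v' →
      ∀ᵐ w ∂μ0, ∀ p, ¬ (E S N v w p ∧ E S N v' w p) := by
  induction v with
  | nil =>
    intro v' h hne
    exact absurd (List.length_eq_zero_iff.1 h.symm).symm hne
  | cons x v ih =>
    rintro (_ | ⟨y, v'⟩) hl hne
    · simp at hl
    have hl' : v.length = v'.length := by simpa using hl
    have h2 : ∀ᵐ w ∂μ0, v ≠ v' → ∀ p, ¬ (E S N v (shift w) p ∧ E S N v' (shift w) p) := by
      by_cases hv : v = v'
      · simp [hv]
      · filter_upwards [(shift_mp μ0 hμ0).quasiMeasurePreserving.ae (ih v' hl' hv)] with w hw _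
        exact hw
    filter_upwards [h2, ae_inj μ0 hN hμ0] with w hw hinj r
    rintro ⟨h3, h4⟩
    rw [E_cons_iff hN] at h3 h4
    obtain ⟨p, ⟨h5, h6⟩, h7⟩ := h3
    obtain ⟨p', ⟨h5', h6'⟩, h7'⟩ := h4
    obtain rfl := hinj p p' (E_nil_of h5) (E_nil_of h5') (h7.trans h7'.symm)
    have hxy : x = y := h6.symm.trans h6'
    subst hxy
    exact hw (fun h => hne (by rw [h])) p ⟨h5, h5'⟩

section Final

variable [MeasurableSpace G] [MeasurableSingletonClass G] [Countable G]

lemma measurable_mk (S : SSA G X) (N : Finset G) :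
    Measurable (Quot.mk (S.AsympEquiv N) : (ℕ → X) × G → S.LimitGSpace N) :=
  fun _ h => h

lemma measurableSet_slices {B : Set ((ℕ → X) × G)} (h : ∀ g, MeasurableSet {w | (w, g) ∈ B}) :
    MeasurableSet B := by
  have : B = ⋃ g, ({w | (w, g) ∈ B} ×ˢ {g}) := by
    ext ⟨w, g⟩; simp
  rw [this]
  exact MeasurableSet.iUnion fun g => (h g).prod (measurableSet_singleton g)

lemma prod_slices [SFinite μ0] {B : Set ((ℕ → X) × G)} (hB : MeasurableSet B) :
    (μ0.prod Measure.count) B = ∑' g : G, μ0 {w | (w, g) ∈ B} := by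
  rw [Measure.prod_apply_symm hB, lintegral_count]
  rfl

lemma limit_apply [SFinite μ0] (S : SSA G X) (N : Finset G) {A : Set (S.LimitGSpace N)}
    (hA : MeasurableSet A) :
    S.limitMeasure N μ0 A =
      ∑' g : G, μ0 {w | (Quot.mk (S.AsympEquiv N) (w, g) : S.LimitGSpace N) ∈ A} := by
  rw [SSA.limitMeasure]
  refine (Measure.map_apply (measurable_mk S N) hA).trans ?_
  exact prod_slices μ0 (measurable_mk S N hA)

lemma measurableSet_tile {S : SSA G X} {N : Finset G} (hN : S.IsNucleus N) (v : List X) :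
    MeasurableSet (S.Tile N v) := by
  change MeasurableSet ((Quot.mk (S.AsympEquiv N)) ⁻¹' (S.Tile N v))
  refine measurableSet_slices fun g => ?_
  have : {w | (w, g) ∈ (Quot.mk (S.AsympEquiv N)) ⁻¹' (S.Tile N v)} = {w | E S N v w g⁻¹} := by
    ext w; exact mem_tile hN v w g
  rw [this]
  exact measurableSet_E hN v _

lemma tile_measure [SFinite μ0] {S : SSA G X} {N : Finset G} (hN : S.IsNucleus N) (v : List X) :
    S.limitMeasure N μ0 (S.Tile N v) = ∑' p : G, μ0 {w | E S N v w p} := by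
  rw [limit_apply μ0 S N (measurableSet_tile hN v)]
  simp only [mem_tile hN]
  exact (Equiv.inv G).tsum_eq (fun p => μ0 {w | E S N v w p})

lemma tile_measure' {S : SSA G X} {N : Finset G} (hN : S.IsNucleus N)
    (hμ0 : ∀ u : List X, μ0 (Cyl u) = ((Fintype.card X : ℝ≥0∞))⁻¹ ^ u.length) (v : List X) :
    S.limitMeasure N μ0 (S.Tile N v) =
      (Fintype.card X : ℝ≥0∞)⁻¹ ^ v.length * S.limitMeasure N μ0 (S.Tile N []) := by
  have := prob μ0 hμ0
  induction v with
  | nil => simp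
  | cons x v ih =>
    rw [tile_measure μ0 hN, sum_cons μ0 hN hμ0, ← tile_measure μ0 hN, ih, ← mul_assoc,
      List.length_cons, pow_succ']

lemma selfsim {S : SSA G X} {N : Finset G} (hN : S.IsNucleus N)
    (hμ0 : ∀ u : List X, μ0 (Cyl u) = ((Fintype.card X : ℝ≥0∞))⁻¹ ^ u.length)
    (τ : X → S.LimitGSpace N → S.LimitGSpace N)
    (hτ : ∀ (x : X) (w : ℕ → X) (g : G),
        τ x (Quot.mk (S.AsympEquiv N) (w, g)) =
          Quot.mk (S.AsympEquiv N) (cns (S.toFun g x) w, S.res g x))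
    (A : Set (S.LimitGSpace N)) (hA : MeasurableSet A) :
    (S.limitMeasure N μ0).restrict (S.Tile N []) A =
          ∑ x : X, (Fintype.card X : ℝ≥0∞)⁻¹ *
            (S.limitMeasure N μ0).restrict (S.Tile N []) (τ x ⁻¹' A) := by
  have := prob μ0 hμ0
  let D : (ℕ → X) → G → Prop := fun w g =>
    (Quot.mk (S.AsympEquiv N) (w, g) : S.LimitGSpace N) ∈ A
  have hD : ∀ g, MeasurableSet {w | D w g} := fun g =>
    measurable_prodMk_right (y := g) (measurable_mk S N hA)
  have hτA : ∀ x, MeasurableSet (τ x ⁻¹' A) := by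
    intro x
    change MeasurableSet ((Quot.mk (S.AsympEquiv N)) ⁻¹' (τ x ⁻¹' A))
    refine measurableSet_slices fun g => ?_
    have : {w | (w, g) ∈ (Quot.mk (S.AsympEquiv N)) ⁻¹' (τ x ⁻¹' A)} =
        cns (S.toFun g x) ⁻¹' {w | D w (S.res g x)} := by
      ext w
      change τ x (Quot.mk (S.AsympEquiv N) (w, g)) ∈ A ↔ _
      rw [hτ]
      rfl
    rw [this]
    exact measurable_cns _ (hD _)
  have hT := measurableSet_tile (S := S) hN []
  -- left-hand side
  have hL : (S.limitMeasure N μ0).restrict (S.Tile N []) A =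
      ∑' r : G, μ0 {w | E S N [] w r ∧ D w r⁻¹} := by
    rw [Measure.restrict_apply hA, limit_apply μ0 S N (hA.inter hT),
      ← (Equiv.inv G).tsum_eq (fun r => μ0 {w | E S N [] w r ∧ D w r⁻¹})]
    refine tsum_congr fun g => ?_
    congr 1
    ext w
    change (D w g ∧ _ ∈ S.Tile N []) ↔ (E S N [] w g⁻¹ ∧ D w (g⁻¹)⁻¹)
    rw [inv_inv, and_comm]
    exact and_congr_left fun _ => mem_tile hN [] w g
  let P : (ℕ → X) → G → Prop := fun w p => E S N [] (shift w) p ∧ D w (S.res p (w 0))⁻¹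
  have hP : ∀ p, MeasurableSet {w | P w p} := by
    intro p
    refine (measurable_shift (measurableSet_E hN [] p)).inter ?_
    have : {w | D w (S.res p (w 0))⁻¹} = ⋃ y : X, ({w | w 0 = y} ∩ {w | D w (S.res p y)⁻¹}) := by
      ext w; simp
    change MeasurableSet {w | D w (S.res p (w 0))⁻¹}
    rw [this]
    exact MeasurableSet.iUnion fun y => (measurableSet_coord 0 (fun z => z = y)).inter (hD _)
  have hLP : ∑' r : G, μ0 {w | E S N [] w r ∧ D w r⁻¹} = ∑' p : G, μ0 {w | P w p} := by
    rw [← key μ0 hN hμ0 P hP (fun w p h => h.1)]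
    refine tsum_congr fun r => ?_
    congr 1
    ext w
    simp only [Set.mem_ofPred_eq, E_nil_iff hN w r, P]
    constructor
    · rintro ⟨⟨p, h1, h2⟩, h3⟩
      exact ⟨p, ⟨h1, by rwa [h2]⟩, h2⟩
    · rintro ⟨p, ⟨h1, h3⟩, h2⟩
      exact ⟨⟨p, h1, h2⟩, by rwa [h2] at h3⟩
  have hR : ∀ x, (S.limitMeasure N μ0).restrict (S.Tile N []) (τ x ⁻¹' A) =
      ∑' p : G, μ0 (cns (S.toFun p⁻¹ x) ⁻¹' {w | P w p}) := by
    intro x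
    rw [Measure.restrict_apply (hτA x), limit_apply μ0 S N ((hτA x).inter hT),
      ← (Equiv.inv G).tsum_eq (fun p => μ0 (cns (S.toFun p⁻¹ x) ⁻¹' {w | P w p}))]
    refine tsum_congr fun g => ?_
    congr 1
    ext w
    change (τ x (Quot.mk (S.AsympEquiv N) (w, g)) ∈ A ∧ _ ∈ S.Tile N []) ↔
      (E S N [] w g⁻¹ ∧ D (cns (S.toFun (g⁻¹)⁻¹ x) w) (S.res g⁻¹ (S.toFun (g⁻¹)⁻¹ x))⁻¹)
    rw [inv_inv, res_inv, inv_inv, hτ, and_comm]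
    exact and_congr_left fun _ => mem_tile hN [] w g
  rw [hL, hLP]
  simp only [hR]
  simp only [← ENNReal.tsum_mul_left]
  rw [← Summable.tsum_finsetSum (fun _ _ => ENNReal.summable)]
  refine tsum_congr fun p => ?_
  rw [decomp μ0 hμ0 (hP p)]
  let e : X ≃ X := ⟨S.toFun p⁻¹, S.toFun p, toFun_inv' S p, toFun_inv S p⟩
  exact (e.sum_comp (fun y => (Fintype.card X : ℝ≥0∞)⁻¹ * μ0 (cns y ⁻¹' {w | P w p}))).symm

end Final

end Meas

end SSAProof

/-- Properties of the measures of tiles in the limit `G`-space: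
(1) `μ(𝒯_v) = |X|^n μ(𝒯_{uv})` for `u ∈ Xⁿ`; (2) distinct tiles of the same level intersect in
measure zero; (3) the restriction of `μ` to the tile `𝒯` satisfies the self-similarity equation
`μ|_𝒯(A) = Σ_x |X|⁻¹ μ|_𝒯(τ_x⁻¹ A)` for Borel `A ⊆ 𝒯`, where `τ_x` is the map induced by
`…x₂x₁·g ↦ …x₂x₁g(x)·g|_x`. -/
theorem stmt_12 {G X : Type*} [Group G] [Fintype X] [Nonempty X]
    [MeasurableSpace X] [MeasurableSpace G] [MeasurableSingletonClass G] [Countable G]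
    (S : SSA G X) (N : Finset G) (hN : S.IsNucleus N)
    (μ0 : Measure (ℕ → X))
    (hμ0 : ∀ u : List X, μ0 (Cyl u) = ((Fintype.card X : ℝ≥0∞))⁻¹ ^ u.length) :
    (∀ v u : List X,
      S.limitMeasure N μ0 (S.Tile N v) =
        (Fintype.card X : ℝ≥0∞) ^ u.length * S.limitMeasure N μ0 (S.Tile N (v ++ u))) ∧
    (∀ v v' : List X, v.length = v'.length → v ≠ v' →
      S.limitMeasure N μ0 (S.Tile N v ∩ S.Tile N v') = 0) ∧
    (∀ τ : X → S.LimitGSpace N → S.LimitGSpace N,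
      (∀ (x : X) (w : ℕ → X) (g : G),
        τ x (Quot.mk (S.AsympEquiv N) (w, g)) =
          Quot.mk (S.AsympEquiv N)
            ((fun i => match i with
              | 0 => S.toFun g x
              | Nat.succ j => w j), S.res g x)) →
      ∀ A : Set (S.LimitGSpace N), MeasurableSet A → A ⊆ S.Tile N [] →
        (S.limitMeasure N μ0).restrict (S.Tile N []) A =
          ∑ x : X, (Fintype.card X : ℝ≥0∞)⁻¹ *
            (S.limitMeasure N μ0).restrict (S.Tile N []) (τ x ⁻¹' A)) := by
  have := SSAProof.singleton_class μ0 hμ0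
  have := SSAProof.prob μ0 hμ0
  refine ⟨?_, ?_, ?_⟩
  · intro v u
    rw [SSAProof.tile_measure' μ0 hN hμ0 v, SSAProof.tile_measure' μ0 hN hμ0 (v ++ u),
      List.length_append, pow_add, ← mul_assoc]
    congr 1
    rw [mul_left_comm, ← mul_pow, SSAProof.card_mul, one_pow, mul_one]
  · intro v v' hl hne
    rw [SSAProof.limit_apply μ0 S N
      ((SSAProof.measurableSet_tile hN v).inter (SSAProof.measurableSet_tile hN v')),
      ENNReal.tsum_eq_zero]
    intro g
    refine measure_mono_null ?_ (ae_iff.1 (SSAProof.ae_disj μ0 hN hμ0 v v' hl hne))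
    rintro w ⟨h1, h2⟩ hall
    exact hall g⁻¹ ⟨(SSAProof.mem_tile hN v w g).1 h1, (SSAProof.mem_tile hN v' w g).1 h2⟩
  · intro τ hτ A hA _
    refine SSAProof.selfsim μ0 hN hμ0 τ (fun x w g => ?_) A hA
    rw [hτ]
    congr 2
    funext i
    cases i <;> rfl
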